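/- Let G be a finite simple graph on [r] = {1,…,r} with r ≥ 3 and no isolated vertices, and suppose G contains no compact vertices (a vertex is compact if it has degree ≥ 3 and lies in a triangle of G). Then for every n ≥ 2 and every a ∈ ℕ^r: if the complex Δ_a(I_G^n) is disconnected, then |a| ≤ 2n − 1. -/

import Mathlib

open MvPolynomial

/-- The Stanley–Reisner ideal of a graph viewed as a one-dimensional simplicial complex. -/
noncomputable def SRIdeal (K : Type*) [Field K] {r : ℕ} (G : SimpleGraph (Fin r)) :
    Ideal (MvPolynomial (Fin r) K) :=
  Ideal.span
    ({p | ∃ i j : Fin r, i ≠ j ∧ ¬ G.Adj i j ∧ p = X i * X j} ∪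
     {p | ∃ i j k : Fin r, i ≠ j ∧ i ≠ k ∧ j ≠ k ∧ p = X i * X j * X k})

/-- Monomial localization `I_G[F]S`. -/
noncomputable def locSR (K : Type*) [Field K] {r : ℕ} (G : SimpleGraph (Fin r))
    (F : Finset (Fin r)) : Ideal (MvPolynomial (Fin r) K) :=
  Ideal.map (aeval (fun i : Fin r => if i ∈ F then 1 else X i) :
      MvPolynomial (Fin r) K →ₐ[K] MvPolynomial (Fin r) K) (SRIdeal K G)

/-- `p` is a vertex of the degree complex `Δ_a(I_G^n)`. -/
def DeltaVert (K : Type*) [Field K] {r : ℕ} (G : SimpleGraph (Fin r))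
    (n : ℕ) (a : Fin r → ℕ) (p : Fin r) : Prop :=
  (∏ i, (X i : MvPolynomial (Fin r) K) ^ a i) ∉ (locSR K G {p}) ^ n

/-- `{p,q}` is an edge of the degree complex `Δ_a(I_G^n)`. -/
def DeltaEdge (K : Type*) [Field K] {r : ℕ} (G : SimpleGraph (Fin r))
    (n : ℕ) (a : Fin r → ℕ) (p q : Fin r) : Prop :=
  p ≠ q ∧ (∏ i, (X i : MvPolynomial (Fin r) K) ^ a i) ∉ (locSR K G {p, q}) ^ n

/-- The degree complex `Δ_a(I_G^n)` is disconnected: two of its vertices cannot be joined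
by a path consisting of its edges. -/
def DeltaDisconnected (K : Type*) [Field K] {r : ℕ} (G : SimpleGraph (Fin r))
    (n : ℕ) (a : Fin r → ℕ) : Prop :=
  ∃ p q : Fin r, DeltaVert K G n a p ∧ DeltaVert K G n a q ∧
    ¬ ∃ (ℓ : ℕ) (f : ℕ → Fin r), f 0 = p ∧ f ℓ = q ∧
        ∀ i < ℓ, DeltaEdge K G n a (f i) (f (i + 1))

/-- A vertex of `G` is compact if it has degree `≥ 3` and lies in a triangle. -/
def IsCompactVertex {r : ℕ} (G : SimpleGraph (Fin r)) [DecidableRel G.Adj]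
    (v : Fin r) : Prop :=
  3 ≤ G.degree v ∧ ∃ x y : Fin r, G.Adj v x ∧ G.Adj v y ∧ G.Adj x y

open Finset in
/-- A monomial lies in the `m`-th power of an ideal containing all products of two distinct
variables from `s`, as soon as `m` disjoint pairs of distinct variables can be extracted. -/
lemma prod_pow_mem_pow_of_pairs {ι R : Type*} [DecidableEq ι] [CommRing R] (I : Ideal R)
    (x : ι → R) (s : Finset ι) (hI : ∀ i ∈ s, ∀ j ∈ s, i ≠ j → x i * x j ∈ I) :
    ∀ (m : ℕ) (a : ι → ℕ), 2 * m ≤ ∑ i ∈ s, a i → (∀ i ∈ s, m + a i ≤ ∑ i ∈ s, a i) →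
      ∏ i ∈ s, x i ^ a i ∈ I ^ m := by
  intro m
  induction m with
  | zero => intro a _ _; simp
  | succ m ih =>
    intro a h2 hm
    have hs : s.Nonempty := by
      by_contra h
      rw [not_nonempty_iff_eq_empty] at h
      subst h
      simp at h2
    obtain ⟨i, hi, hmax⟩ := exists_max_image s a hs
    have hsi : ∑ k ∈ s, a k = a i + ∑ k ∈ s.erase i, a k := (add_sum_erase s a hi).symm
    have hmi := hm i hi
    have hs' : (s.erase i).Nonempty := by
      by_contra h
      rw [not_nonempty_iff_eq_empty] at h
      rw [h] at hsi
      simp at hsi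
      omega
    obtain ⟨j, hj, hmaxj⟩ := exists_max_image (s.erase i) a hs'
    have hji : j ≠ i := (mem_erase.mp hj).1
    have hjs : j ∈ s := (mem_erase.mp hj).2
    have hsj : ∑ k ∈ s.erase i, a k = a j + ∑ k ∈ (s.erase i).erase j, a k :=
      (add_sum_erase _ a hj).symm
    have hpos : 1 ≤ a j := by
      by_contra h
      have : ∑ k ∈ s.erase i, a k = 0 :=
        sum_eq_zero fun k hk => by have := hmaxj k hk; omega
      omega
    have hij := hmax j hjs
    set b : ι → ℕ := fun k => if k = i ∨ k = j then a k - 1 else a k with hb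
    have hbi : b i = a i - 1 := by simp [hb]
    have hbj : b j = a j - 1 := by simp [hb]
    have hbk : ∀ k ∈ (s.erase i).erase j, b k = a k := by
      intro k hk
      simp only [mem_erase] at hk
      simp [hb, hk.1, hk.2.1]
    have hbsum : ∑ k ∈ s, b k = b i + (b j + ∑ k ∈ (s.erase i).erase j, a k) := by
      rw [← add_sum_erase s b hi, ← add_sum_erase _ b hj, sum_congr rfl hbk]
    have hprod : ∏ k ∈ s, x k ^ a k = (x i * x j) * ∏ k ∈ s, x k ^ b k := by
      rw [← mul_prod_erase s _ hi, ← mul_prod_erase _ _ hj,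
        ← mul_prod_erase s (fun k => x k ^ b k) hi, ← mul_prod_erase _ (fun k => x k ^ b k) hj,
        prod_congr rfl fun k hk => by rw [← hbk k hk], hbi, hbj]
      obtain ⟨u, hu⟩ : ∃ u, a i = u + 1 := ⟨a i - 1, by omega⟩
      obtain ⟨v, hv⟩ : ∃ v, a j = v + 1 := ⟨a j - 1, by omega⟩
      rw [hu, hv]
      simp only [Nat.add_sub_cancel]
      ring
    rw [hprod, pow_succ']
    refine Ideal.mul_mem_mul (hI i hi j hjs hji.symm) (ih b (by omega) fun k hk => ?_)
    by_cases hki : k = i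
    · subst hki; omega
    by_cases hkj : k = j
    · subst hkj; omega
    have hk' : k ∈ (s.erase i).erase j := by simp [hki, hkj, hk]
    have h1 := single_le_sum (f := a) (fun _ _ => Nat.zero_le _) hk'
    have h3 := hmaxj k (mem_of_mem_erase hk')
    rw [hbk k hk']
    omega

lemma prod_pow_mem_pow_sum {ι R : Type*} [CommRing R] (I : Ideal R) (x : ι → R) (s : Finset ι)
    (a : ι → ℕ) (hI : ∀ i ∈ s, x i ∈ I) : ∏ i ∈ s, x i ^ a i ∈ I ^ ∑ i ∈ s, a i := by
  rw [← Finset.prod_pow_eq_pow_sum]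
  exact Ideal.prod_mem_prod fun i hi => Ideal.pow_mem_pow (hI i hi) _

section DegreeComplex

variable (K : Type*) [Field K] {r : ℕ} (G : SimpleGraph (Fin r))

lemma X_mem_locSR_singleton {p i : Fin r} (hne : i ≠ p) (hadj : ¬ G.Adj p i) :
    (X i : MvPolynomial (Fin r) K) ∈ locSR K G {p} := by
  have h : (X p * X i : MvPolynomial (Fin r) K) ∈ SRIdeal K G :=
    Ideal.subset_span (Or.inl ⟨p, i, hne.symm, hadj, rfl⟩)
  have h' := Ideal.mem_map_of_mem
    (aeval (fun i : Fin r => if i ∈ ({p} : Finset (Fin r)) then 1 else X i) :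
      MvPolynomial (Fin r) K →ₐ[K] MvPolynomial (Fin r) K) h
  simpa only [locSR, map_mul, aeval_X, Finset.mem_singleton, if_true, if_neg hne, one_mul] using h'

lemma X_mul_X_mem_locSR_singleton {p i j : Fin r} (hij : i ≠ j) (hi : i ≠ p) (hj : j ≠ p) :
    (X i * X j : MvPolynomial (Fin r) K) ∈ locSR K G {p} := by
  have h : (X p * X i * X j : MvPolynomial (Fin r) K) ∈ SRIdeal K G :=
    Ideal.subset_span (Or.inr ⟨p, i, j, hi.symm, hj.symm, hij, rfl⟩)
  have h' := Ideal.mem_map_of_mem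
    (aeval (fun i : Fin r => if i ∈ ({p} : Finset (Fin r)) then 1 else X i) :
      MvPolynomial (Fin r) K →ₐ[K] MvPolynomial (Fin r) K) h
  simpa only [locSR, map_mul, aeval_X, Finset.mem_singleton, if_true, if_neg hi, if_neg hj,
    one_mul] using h'

variable {G}

open Finset in
lemma deltaEdge_of_sum_lt {n : ℕ} {a : Fin r → ℕ} {p q : Fin r} (hpq : G.Adj p q)
    (hlt : ∑ k ∈ univ.filter (fun k => k ≠ p ∧ k ≠ q), a k < n) : DeltaEdge K G n a p q := by
  refine ⟨hpq.ne, fun hmem => ?_⟩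
  let φ : MvPolynomial (Fin r) K →ₐ[K] Polynomial K :=
    aeval fun k => if k = p ∨ k = q then 1 else Polynomial.X
  have hφ : ∀ k, φ (X k) = if k = p ∨ k = q then 1 else Polynomial.X := fun k => by simp [φ]
  have hdvd : ∀ k, k ≠ p → k ≠ q → Polynomial.X ∣ φ (X k) := fun k h1 h2 => by
    rw [hφ, if_neg (by tauto)]
  have hle : locSR K G {p, q} ≤ (Ideal.span {(Polynomial.X : Polynomial K)}).comap φ := by
    rw [locSR, Ideal.map_le_iff_le_comap, SRIdeal, Ideal.span_le]
    have hcomp : ∀ f : MvPolynomial (Fin r) K,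
        φ (aeval (fun i : Fin r => if i ∈ ({p, q} : Finset (Fin r)) then 1 else X i) f) = φ f := by
      intro f
      rw [← AlgHom.comp_apply]
      congr 1
      ext k
      by_cases h : k = p ∨ k = q <;> simp [h, hφ]
    rintro f (⟨i, j, hij, hadj, rfl⟩ | ⟨i, j, k, hij, hik, hjk, rfl⟩)
    · simp only [SetLike.mem_coe, Ideal.mem_comap, hcomp, Ideal.mem_span_singleton, map_mul]
      by_cases hi : i ≠ p ∧ i ≠ q
      · exact (hdvd i hi.1 hi.2).mul_right _
      · refine (hdvd j ?_ ?_).mul_left _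
        · rintro rfl
          have : i = q := by tauto
          exact hadj (this ▸ hpq.symm)
        · rintro rfl
          have : i = p := by tauto
          exact hadj (this ▸ hpq)
    · simp only [SetLike.mem_coe, Ideal.mem_comap, hcomp, Ideal.mem_span_singleton, map_mul]
      by_cases hi : i ≠ p ∧ i ≠ q
      · exact ((hdvd i hi.1 hi.2).mul_right _).mul_right _
      by_cases hj : j ≠ p ∧ j ≠ q
      · exact ((hdvd j hj.1 hj.2).mul_left _).mul_right _
      · refine (hdvd k ?_ ?_).mul_left _ <;> grind
  have h := Ideal.le_comap_pow φ n (Ideal.pow_right_mono hle n hmem)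
  rw [Ideal.mem_comap, Ideal.span_singleton_pow, Ideal.mem_span_singleton, map_prod] at h
  have heq : ∏ k, φ (X k ^ a k) =
      Polynomial.X ^ ∑ k ∈ univ.filter (fun k => k ≠ p ∧ k ≠ q), a k := by
    rw [← prod_pow_eq_pow_sum, prod_filter]
    refine prod_congr rfl fun k _ => ?_
    rw [map_pow, hφ]
    by_cases h : k = p ∨ k = q
    · rw [if_pos h, if_neg (by tauto), one_pow]
    · rw [if_neg h, if_pos (by tauto)]
  rw [heq, Polynomial.X_pow_dvd_iff] at h
  simpa using h _ hlt

variable [DecidableRel G.Adj]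

open Finset in
lemma sum_add_lt_of_deltaVert {n m : ℕ} {a : Fin r → ℕ} {p : Fin r} (hp : DeltaVert K G n a p)
    (hm2 : 2 * m ≤ ∑ k ∈ univ.filter (G.Adj p), a k)
    (hm : ∀ i, G.Adj p i → m + a i ≤ ∑ k ∈ univ.filter (G.Adj p), a k) :
    ∑ k ∈ univ.filter (fun k => k ≠ p ∧ ¬ G.Adj p k), a k + m < n := by
  by_contra! hle
  refine hp (Ideal.pow_le_pow_right hle ?_)
  have h1 := prod_pow_mem_pow_sum (locSR K G {p}) (fun k => (X k : MvPolynomial (Fin r) K))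
    (univ.filter (fun k => k ≠ p ∧ ¬ G.Adj p k)) a fun i hi =>
      X_mem_locSR_singleton K G (mem_filter.mp hi).2.1 (mem_filter.mp hi).2.2
  have h2 := prod_pow_mem_pow_of_pairs (locSR K G {p})
    (fun k => (X k : MvPolynomial (Fin r) K)) (univ.filter (G.Adj p))
    (fun i hi j hj hij => X_mul_X_mem_locSR_singleton K G hij (mem_filter.mp hi).2.ne'
      (mem_filter.mp hj).2.ne') m a hm2 fun i hi => hm i (mem_filter.mp hi).2
  have h := Ideal.mul_mem_mul h1 h2
  rw [← pow_add] at h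
  refine Ideal.mem_of_dvd _ ?_ h
  rw [← prod_union]
  · exact prod_dvd_prod_of_subset _ _ _ (subset_univ _)
  · rw [disjoint_filter]
    tauto

open Finset in
/-- A vertex of the degree complex either lies on an edge, or has degree at least `3` in `G`
and its link carries a balanced exponent. -/
lemma deltaVert_dichotomy {n : ℕ} {a : Fin r → ℕ} {p : Fin r} (hiso : ∃ w, G.Adj p w)
    (hp : DeltaVert K G n a p) :
    (∃ q, G.Adj p q ∧ ∑ k ∈ univ.filter (fun k => k ≠ p ∧ k ≠ q), a k < n) ∨
    (3 ≤ G.degree p ∧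
      ∑ k ∈ univ.filter (fun k => k ≠ p ∧ ¬ G.Adj p k), a k +
        (∑ k ∈ univ.filter (G.Adj p), a k) / 2 < n ∧
      ∀ i, G.Adj p i → a i ≤ (∑ k ∈ univ.filter (G.Adj p), a k) / 2) := by
  obtain ⟨w, hw⟩ := hiso
  obtain ⟨q, hq, hmax⟩ := exists_max_image (univ.filter (G.Adj p)) a ⟨w, by simp [hw]⟩
  have hqs := single_le_sum (f := a) (fun _ _ => Nat.zero_le _) hq
  have hpq : G.Adj p q := (mem_filter.mp hq).2
  have hmax' : ∀ i, G.Adj p i → a i ≤ a q := fun i hi => hmax i (by simp [hi])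
  have hvert := fun m => sum_add_lt_of_deltaVert K (m := m) hp
  have hcard := sum_le_card_nsmul _ a _ hmax
  have hsplit : ∑ k ∈ univ.filter (fun k => k ≠ p ∧ k ≠ q), a k + a q =
      ∑ k ∈ univ.filter (fun k => k ≠ p ∧ ¬ G.Adj p k), a k
        + ∑ k ∈ univ.filter (G.Adj p), a k := by
    have h1 : a q = ∑ k, if k = q then a k else 0 := by simp
    rw [h1]
    simp only [sum_filter]
    rw [← sum_add_distrib, ← sum_add_distrib]
    refine sum_congr rfl fun k _ => ?_
    by_cases hkp : k = p
    · subst hkp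
      simp [hpq.ne]
    by_cases hkq : k = q
    · subst hkq
      simp [hpq]
    by_cases hk : G.Adj p k <;> simp [hkp, hkq, hk]
  set B := ∑ k ∈ univ.filter (G.Adj p), a k with hB
  by_cases hbal : B - a q ≤ B / 2
  · left
    refine ⟨q, hpq, ?_⟩
    have := hvert (B - a q) (by omega) fun i hi => by have := hmax' i hi; omega
    omega
  · right
    refine ⟨?_, hvert (B / 2) (by omega) fun i hi => by have := hmax' i hi; omega,
      fun i hi => by have := hmax' i hi; omega⟩
    rw [← G.card_neighborFinset_eq_degree, G.neighborFinset_eq_filter]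
    by_contra! hlt
    have : #(univ.filter (G.Adj p)) • a q ≤ 2 * a q :=
      Nat.mul_le_mul_right _ (by convert Nat.le_of_lt_succ hlt)
    omega

open Finset in
lemma sum_lt_of_balanced_of_edge {n : ℕ} {a : Fin r → ℕ} {p q q' : Fin r}
    (htri : ∀ x y, G.Adj p x → G.Adj p y → ¬ G.Adj x y)
    (hp : ∑ k ∈ univ.filter (fun k => k ≠ p ∧ ¬ G.Adj p k), a k +
      (∑ k ∈ univ.filter (G.Adj p), a k) / 2 < n)
    (hbal : ∀ i, G.Adj p i → a i ≤ (∑ k ∈ univ.filter (G.Adj p), a k) / 2)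
    (hqq : G.Adj q q') (hq : q ≠ p) (hq' : q' ≠ p)
    (hedge : ∑ k ∈ univ.filter (fun k => k ≠ q ∧ k ≠ q'), a k < n) :
    ∑ k, a k < 2 * n := by
  have hsplit : ∑ k, a k = ∑ k ∈ univ.filter (fun k => k ≠ q ∧ k ≠ q'), a k + (a q + a q') := by
    rw [← sum_pair hqq.ne, ← sum_filter_add_sum_filter_not univ (fun k => k ≠ q ∧ k ≠ q')]
    congr 2
    ext k
    simp
    tauto
  have hsingle : ∀ k, k ≠ p → ¬ G.Adj p k →
      a k ≤ ∑ k ∈ univ.filter (fun k => k ≠ p ∧ ¬ G.Adj p k), a k := fun k h1 h2 =>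
    single_le_sum (f := a) (fun _ _ => Nat.zero_le _) (by simp [h1, h2])
  by_cases h1 : G.Adj p q
  · have h2 : ¬ G.Adj p q' := fun h2 => htri q q' h1 h2 hqq
    have := hsingle q' hq' h2
    have := hbal q h1
    omega
  · by_cases h2 : G.Adj p q'
    · have := hsingle q hq h1
      have := hbal q' h2
      omega
    · have : a q + a q' ≤ ∑ k ∈ univ.filter (fun k => k ≠ p ∧ ¬ G.Adj p k), a k := by
        rw [← sum_pair hqq.ne]
        refine sum_le_sum_of_subset fun k hk => ?_
        simp only [mem_insert, mem_singleton] at hk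
        rcases hk with rfl | rfl <;> simp [*]
      omega

open Finset in
lemma sum_lt_of_balanced_of_balanced {n : ℕ} {a : Fin r → ℕ} {p q : Fin r} (hpq : p ≠ q)
    (htri : ∀ x y, G.Adj p x → G.Adj p y → ¬ G.Adj x y)
    (hp : ∑ k ∈ univ.filter (fun k => k ≠ p ∧ ¬ G.Adj p k), a k +
      (∑ k ∈ univ.filter (G.Adj p), a k) / 2 < n)
    (hpbal : ∀ i, G.Adj p i → a i ≤ (∑ k ∈ univ.filter (G.Adj p), a k) / 2)
    (hq : ∑ k ∈ univ.filter (fun k => k ≠ q ∧ ¬ G.Adj q k), a k +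
      (∑ k ∈ univ.filter (G.Adj q), a k) / 2 < n)
    (hqbal : ∀ i, G.Adj q i → a i ≤ (∑ k ∈ univ.filter (G.Adj q), a k) / 2) :
    ∑ k, a k < 2 * n := by
  by_cases hadj : G.Adj p q
  · have hsum : ∑ k, a k ≤ ∑ k ∈ univ.filter (fun k => k ≠ p ∧ ¬ G.Adj p k), a k +
        ∑ k ∈ univ.filter (fun k => k ≠ q ∧ ¬ G.Adj q k), a k +
        ((∑ k, if k = p then a k else 0) + ∑ k, if k = q then a k else 0) := by
      simp only [sum_filter]
      rw [← sum_add_distrib, ← sum_add_distrib, ← sum_add_distrib]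
      refine sum_le_sum fun k _ => ?_
      have := htri q k hadj
      by_cases hkp : k = p
      · simp [hkp, hpq, hadj.symm]
      by_cases hkq : k = q
      · simp [hkq, hpq.symm, hadj]
      by_cases h1 : G.Adj p k
      · simp [hkp, hkq, h1, this h1]
      · simp [hkp, hkq, h1]
    have h1 := hpbal q hadj
    have h2 := hqbal p hadj.symm
    simp only [sum_ite_eq', mem_univ, if_true] at hsum
    omega
  · have hsum : ∑ k, a k ≤ ∑ k ∈ univ.filter (fun k => k ≠ p ∧ ¬ G.Adj p k), a k +
        ∑ k ∈ univ.filter (fun k => k ≠ q ∧ ¬ G.Adj q k), a k +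
        ∑ k ∈ univ.filter (fun k => G.Adj p k ∧ G.Adj q k), a k := by
      simp only [sum_filter]
      rw [← sum_add_distrib, ← sum_add_distrib]
      refine sum_le_sum fun k _ => ?_
      have hadj' : ¬ G.Adj q p := fun h => hadj h.symm
      by_cases hkp : k = p
      · subst hkp
        simp [hpq, hadj']
      by_cases hkq : k = q
      · subst hkq
        simp [hkp, hadj]
      by_cases h1 : G.Adj p k <;> by_cases h2 : G.Adj q k <;> simp [hkp, hkq, h1, h2]
    have h1 : ∑ k ∈ univ.filter (fun k => G.Adj p k ∧ G.Adj q k), a k ≤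
        ∑ k ∈ univ.filter (G.Adj p), a k :=
      sum_le_sum_of_subset fun k hk => by simp at hk ⊢; exact hk.1
    have h2 : ∑ k ∈ univ.filter (fun k => G.Adj p k ∧ G.Adj q k), a k ≤
        ∑ k ∈ univ.filter (G.Adj q), a k :=
      sum_le_sum_of_subset fun k hk => by simp at hk ⊢; exact hk.2
    omega

open Finset in
lemma sum_lt_of_edge_of_edge {ι : Type*} [Fintype ι] [DecidableEq ι] {n : ℕ} {a : ι → ℕ}
    {p p' q q' : ι} (h1 : p ≠ q) (h2 : p ≠ q') (h3 : p' ≠ q) (h4 : p' ≠ q')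
    (hp : ∑ k ∈ univ.filter (fun k => k ≠ p ∧ k ≠ p'), a k < n)
    (hq : ∑ k ∈ univ.filter (fun k => k ≠ q ∧ k ≠ q'), a k < n) :
    ∑ k, a k < 2 * n := by
  have hsum : ∑ k, a k ≤ ∑ k ∈ univ.filter (fun k => k ≠ p ∧ k ≠ p'), a k +
      ∑ k ∈ univ.filter (fun k => k ≠ q ∧ k ≠ q'), a k := by
    simp only [sum_filter]
    rw [← sum_add_distrib]
    refine sum_le_sum fun k _ => ?_
    by_cases hk : k ≠ p ∧ k ≠ p'
    · simp [hk]
    · have : k ≠ q ∧ k ≠ q' := by grind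
      simp [this]
  omega

end DegreeComplex

theorem stmt_16 (K : Type*) [Field K] {r : ℕ} (hr : 3 ≤ r) (G : SimpleGraph (Fin r))
    [DecidableRel G.Adj]
    (hiso : ∀ v : Fin r, ∃ w : Fin r, G.Adj v w)
    (hcomp : ∀ v : Fin r, ¬ IsCompactVertex G v)
    (n : ℕ) (hn : 2 ≤ n) (a : Fin r → ℕ)
    (hdis : DeltaDisconnected K G n a) :
    (∑ i, a i) ≤ 2 * n - 1 := by
  obtain ⟨p, q, hp, hq, hno⟩ := hdis
  have htri : ∀ v, 3 ≤ G.degree v → ∀ x y, G.Adj v x → G.Adj v y → ¬ G.Adj x y :=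
    fun v hv x y hx hy hxy => hcomp v ⟨hv, x, y, hx, hy, hxy⟩
  have hnil : p ≠ q := fun h => hno ⟨0, fun _ => p, rfl, h, by simp⟩
  have hedge : ¬ DeltaEdge K G n a p q := fun h =>
    hno ⟨1, fun i => if i = 0 then p else q, rfl, rfl, fun i hi => by
      obtain rfl : i = 0 := by omega
      simpa using h⟩
  have hpath : ∀ w, DeltaEdge K G n a p w → ¬ DeltaEdge K G n a w q := fun w h1 h2 =>
    hno ⟨2, fun i => if i = 0 then p else if i = 1 then w else q, rfl, rfl, fun i hi => by
      obtain rfl | rfl : i = 0 ∨ i = 1 := by omega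
      · simpa using h1
      · simpa using h2⟩
  have hsymm : ∀ {u v}, DeltaEdge K G n a u v → DeltaEdge K G n a v u := fun h =>
    ⟨h.1.symm, Finset.pair_comm (_ : Fin r) _ ▸ h.2⟩
  suffices ∑ i, a i < 2 * n by omega
  rcases deltaVert_dichotomy K (hiso p) hp with ⟨p', hpp, hps⟩ | ⟨hpd, hps, hpb⟩
  · have hpe := deltaEdge_of_sum_lt K hpp hps
    have hp'q : p' ≠ q := by rintro rfl; exact hedge hpe
    rcases deltaVert_dichotomy K (hiso q) hq with ⟨q', hqq, hqs⟩ | ⟨hqd, hqs, hqb⟩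
    · have hqe := deltaEdge_of_sum_lt K hqq hqs
      refine sum_lt_of_edge_of_edge hnil ?_ hp'q ?_ hps hqs
      · rintro rfl
        exact hedge (hsymm hqe)
      · rintro rfl
        exact hpath _ hpe (hsymm hqe)
    · exact sum_lt_of_balanced_of_edge (htri q hqd) hqs hqb hpp hnil hp'q hps
  · rcases deltaVert_dichotomy K (hiso q) hq with ⟨q', hqq, hqs⟩ | ⟨hqd, hqs, hqb⟩
    · have hqe := deltaEdge_of_sum_lt K hqq hqs
      refine sum_lt_of_balanced_of_edge (htri p hpd) hps hpb hqq hnil.symm ?_ hqs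
      rintro rfl
      exact hedge (hsymm hqe)
    · exact sum_lt_of_balanced_of_balanced hnil (htri p hpd) hps hpb hqs hqb
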